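/- Let r ≥ 1 and let T be a DAG with a unique sink such that Visit(T) = Pers(T) = r. Let H := mold(T), let a := s be its special source, let b := z^out where z is the sink of T, and set R := V(H) and R̃ := V(H) ∖ {a}. Then Pers_R(b) = Visit_R(b) = r + 2 and Pers_{R̃}(b) = Visit_{R̃}(b) = r + 1. -/

import Mathlib

/-! ## Directed graphs and pebbling -/

structure Dgraph where
  V : Type
  [fintypeV : Fintype V]
  [decEqV : DecidableEq V]
  edge : V → V → Prop

attribute [instance] Dgraph.fintypeV Dgraph.decEqV

namespace Dgraph

/-- A directed graph is acyclic if no vertex lies on a directed cycle. -/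
def Acyclic (G : Dgraph) : Prop :=
  ∀ v : G.V, ¬ Relation.TransGen G.edge v v

def IsSink (G : Dgraph) (z : G.V) : Prop := ∀ u : G.V, ¬ G.edge z u

def IsSource (G : Dgraph) (v : G.V) : Prop := ∀ u : G.V, ¬ G.edge u v

def UniqueSink (G : Dgraph) (z : G.V) : Prop :=
  G.IsSink z ∧ ∀ w : G.V, G.IsSink w → w = z

/-- Every vertex has in-degree at most 2. -/
def InDegLe2 (G : Dgraph) : Prop :=
  ∀ v : G.V, {u : G.V | G.edge u v}.ncard ≤ 2

/-- One step of the reversible pebble game. -/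
def RevStep (G : Dgraph) (P P' : Finset G.V) : Prop :=
  (∃ v : G.V, v ∉ P ∧ (∀ u : G.V, G.edge u v → u ∈ P) ∧ P' = insert v P) ∨
  (∃ v : G.V, v ∈ P ∧ (∀ u : G.V, G.edge u v → u ∈ P) ∧ P' = P.erase v)

/-- One step of the standard pebble game. -/
def StdStep (G : Dgraph) (P P' : Finset G.V) : Prop :=
  (∃ v : G.V, v ∉ P ∧ (∀ u : G.V, G.edge u v → u ∈ P) ∧ P' = insert v P) ∨
  (∃ v : G.V, v ∈ P ∧ P' = P.erase v)

/-- An unconditional reversible pebbling of time `τ`. -/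
def IsRevPebbling (G : Dgraph) (P : ℕ → Finset G.V) (τ : ℕ) : Prop :=
  P 0 = ∅ ∧ ∀ t < τ, G.RevStep (P t) (P (t+1))

/-- An unconditional standard pebbling of time `τ`. -/
def IsStdPebbling (G : Dgraph) (P : ℕ → Finset G.V) (τ : ℕ) : Prop :=
  P 0 = ∅ ∧ ∀ t < τ, G.StdStep (P t) (P (t+1))

/-- The space of a pebbling. -/
def space (G : Dgraph) (P : ℕ → Finset G.V) (τ : ℕ) : ℕ :=
  (Finset.range (τ+1)).sup fun t => (P t).card

/-- Persistent (reversible) pebbling price of a vertex. -/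
noncomputable def pers (G : Dgraph) (v : G.V) : ℕ :=
  sInf { s : ℕ | ∃ P τ, G.IsRevPebbling P τ ∧ P τ = {v} ∧ G.space P τ = s }

/-- Visiting (reversible) pebbling price of a vertex. -/
noncomputable def visit (G : Dgraph) (v : G.V) : ℕ :=
  sInf { s : ℕ | ∃ P τ, G.IsRevPebbling P τ ∧ v ∈ P τ ∧ G.space P τ = s }

/-- Surrounding (reversible) pebbling price of a vertex. -/
noncomputable def surround (G : Dgraph) (v : G.V) : ℕ :=
  sInf { s : ℕ | ∃ P τ, G.IsRevPebbling P τ ∧ (∀ u : G.V, G.edge u v → u ∈ P τ) ∧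
    G.space P τ = s }

/-- Standard pebbling price of a vertex. -/
noncomputable def black (G : Dgraph) (z : G.V) : ℕ :=
  sInf { s : ℕ | ∃ P τ, G.IsStdPebbling P τ ∧ P τ = {z} ∧ G.space P τ = s }

/-- Space of a pebbling counted only inside the region `R`. -/
noncomputable def spaceIn (G : Dgraph) (R : Set G.V) (P : ℕ → Finset G.V) (τ : ℕ) : ℕ :=
  (Finset.range (τ+1)).sup fun t => ((P t : Set G.V) ∩ R).ncard

/-- `R`-restricted persistent price. -/
noncomputable def persIn (G : Dgraph) (R : Set G.V) (v : G.V) : ℕ :=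
  sInf { s : ℕ | ∃ P τ, G.IsRevPebbling P τ ∧ ((P τ : Set G.V) ∩ R) = {v} ∧
    G.spaceIn R P τ = s }

/-- `R`-restricted visiting price. -/
noncomputable def visitIn (G : Dgraph) (R : Set G.V) (v : G.V) : ℕ :=
  sInf { s : ℕ | ∃ P τ, G.IsRevPebbling P τ ∧ v ∈ P τ ∧ G.spaceIn R P τ = s }

/-- `R`-restricted surrounding price. -/
noncomputable def surroundIn (G : Dgraph) (R : Set G.V) (v : G.V) : ℕ :=
  sInf { s : ℕ | ∃ P τ, G.IsRevPebbling P τ ∧ (∀ u : G.V, G.edge u v → u ∈ P τ) ∧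
    G.spaceIn R P τ = s }

/-- `B` blocks the graph: every directed path from a source to a sink meets `B`. -/
def Blocks (G : Dgraph) (B : Set G.V) : Prop :=
  ∀ (p : List G.V) (hp : p ≠ []), List.Chain' G.edge p →
    G.IsSource (p.head hp) → G.IsSink (p.getLast hp) → ∃ v ∈ p, v ∈ B

/-- A minimal blocking set. -/
def MinBlocking (G : Dgraph) (B : Set G.V) : Prop :=
  G.Blocks B ∧ ∀ B' : Set G.V, B' ⊂ B → ¬ G.Blocks B'

end Dgraph

/-! ## Concrete graph families -/

/-- The function `g` with `g 1 = 0` and `g Δ = 2^(g (Δ-1) + Δ - 2) + g (Δ-1)` for `Δ ≥ 2`. -/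
def g : ℕ → ℕ
  | 0 => 0
  | 1 => 0
  | (n+2) => 2 ^ (g (n+1) + n) + g (n+1)

/-- `ginv h = min {Δ ≥ 1 | g Δ ≥ h}`. -/
noncomputable def ginv (h : ℕ) : ℕ := sInf { Δ : ℕ | 1 ≤ Δ ∧ h ≤ g Δ }

/-- The pyramid of height `h`: vertices `(i,j)` with `i ≤ j ≤ h`, vertex `(i,j)` is
at level `i`, with edges `(i,j) → (i+1,j)` and `(i,j) → (i+1,j+1)` (when the target
is a vertex). -/
def pyramid (h : ℕ) : Dgraph where
  V := {p : Fin (h+1) × Fin (h+1) // (p.1 : ℕ) ≤ (p.2 : ℕ)}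
  edge u v := (v.1.1 : ℕ) = (u.1.1 : ℕ) + 1 ∧
    ((v.1.2 : ℕ) = (u.1.2 : ℕ) ∨ (v.1.2 : ℕ) = (u.1.2 : ℕ) + 1)

/-- The sink `(h,h)` of the pyramid of height `h`. -/
def pyramidSink (h : ℕ) : (pyramid h).V := ⟨(Fin.last h, Fin.last h), le_refl _⟩

/-- The complete binary tree of height `h`, with edges directed towards the root:
the vertex `⟨k, j⟩` is the `j`-th node at depth `k`, and its parent is `⟨k-1, j/2⟩`. -/
def bintree (h : ℕ) : Dgraph where
  V := Σ k : Fin (h+1), Fin (2 ^ (k : ℕ))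
  edge u v := (u.1 : ℕ) = (v.1 : ℕ) + 1 ∧ (u.2 : ℕ) / 2 = (v.2 : ℕ)

/-- The root (unique sink) of the complete binary tree. -/
def bintreeRoot (h : ℕ) : (bintree h).V := ⟨0, ⟨0, by positivity⟩⟩

/-- The chain of width `w` and length `ℓ`: layers `0,…,ℓ` of `w` vertices each, where the
`j`-th vertex of layer `i ≥ 1` has incoming edges from the `j`-th and `(j+1 mod w)`-th
vertices of layer `i-1`. -/
def chainDag (w ℓ : ℕ) : Dgraph where
  V := Fin (ℓ+1) × Fin w
  edge u v := (v.1 : ℕ) = (u.1 : ℕ) + 1 ∧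
    ((u.2 : ℕ) = (v.2 : ℕ) ∨ (u.2 : ℕ) = ((v.2 : ℕ) + 1) % w)

/-- The road of width `w` and length `ℓ`: a chain of width `w` and length `ℓ-w+1`
(layers `0,…,ℓ-w+1`) followed by a pyramid of height `w-1` whose sources are the vertices
of layer `ℓ-w+1`; layer `i` consists of the vertices `(i,j)` with `i + j ≤ ℓ`, `j < w`. -/
def road (w ℓ : ℕ) : Dgraph where
  V := {p : Fin (ℓ+1) × Fin w // (p.1 : ℕ) + (p.2 : ℕ) ≤ ℓ}
  edge u v := (v.1.1 : ℕ) = (u.1.1 : ℕ) + 1 ∧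
    ((u.1.2 : ℕ) = (v.1.2 : ℕ) ∨ (u.1.2 : ℕ) = ((v.1.2 : ℕ) + 1) % w)

/-- The sink of the road: the single vertex on the last layer. -/
def roadSink (w ℓ : ℕ) (hw : 0 < w) : (road w ℓ).V :=
  ⟨(Fin.last ℓ, ⟨0, hw⟩), by simp⟩

/-- The directed path of length `h`: vertices `0,…,h` and edges `i → i+1`. -/
def pathDag (h : ℕ) : Dgraph where
  V := Fin (h+1)
  edge u v := (v : ℕ) = (u : ℕ) + 1

/-- The sink of the directed path. -/
def pathSink (h : ℕ) : (pathDag h).V := Fin.last h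

/-- The `(h,ℓ)`-teabag: the pyramid of height `h` with a directed path of length `ℓ`
appended to its sink.  Layer `t ≤ h` consists of the pyramid vertices `(t,j)`, `t ≤ j ≤ h`,
and layer `t > h` consists of the single path vertex `(t,h)`. -/
def teabag (h ℓ : ℕ) : Dgraph where
  V := {p : Fin (h+ℓ+1) × Fin (h+1) //
          ((p.1 : ℕ) ≤ h → (p.1 : ℕ) ≤ (p.2 : ℕ)) ∧ (h ≤ (p.1 : ℕ) → (p.2 : ℕ) = h)}
  edge u v := (v.1.1 : ℕ) = (u.1.1 : ℕ) + 1 ∧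
    ((v.1.2 : ℕ) = (u.1.2 : ℕ) ∨ (v.1.2 : ℕ) = (u.1.2 : ℕ) + 1)

/-- The sink of the `(h,ℓ)`-teabag: the final path vertex. -/
def teabagSink (h ℓ : ℕ) : (teabag h ℓ).V :=
  ⟨(Fin.last (h+ℓ), Fin.last h), by refine ⟨fun hh => ?_, fun _ => ?_⟩ <;> simp_all⟩

/-- The molding `mold G` of a graph `G`: vertices `s` (= `none`), `v^in` (= `some (v,false)`)
and `v^out` (= `some (v,true)`) for `v ∈ V(G)`, with edges `v^in → v^out`,
`u^out → v^in` for every edge `(u,v)` of `G`, and `s → v^out` for every `v`. -/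
def mold (G : Dgraph) : Dgraph where
  V := Option (G.V × Bool)
  edge u v :=
    match u, v with
    | none, some (_, true) => True
    | some (a, false), some (b, true) => a = b
    | some (a, true), some (b, false) => G.edge a b
    | _, _ => False

/-- The special source `s` of `mold G`. -/
def moldSrc (G : Dgraph) : (mold G).V := none

/-- The vertex `v^out` of `mold G`. -/
def moldOut (G : Dgraph) (v : G.V) : (mold G).V := some (v, true)

/-- Configurations reachable from the empty one through configurations satisfying `c`. -/
inductive Rch (G : Dgraph) (c : Finset G.V → Prop) : Finset G.V → Prop
  | nil : c ∅ → Rch G c ∅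
  | step (P P' : Finset G.V) : Rch G c P → G.RevStep P P' → c P' → Rch G c P'

theorem Rch.exists_pebbling {G : Dgraph} {c : Finset G.V → Prop} {Q : Finset G.V}
    (h : Rch G c Q) : ∃ P τ, G.IsRevPebbling P τ ∧ P τ = Q ∧ ∀ t ≤ τ, c (P t) := by
  induction h with
  | nil h => exact ⟨fun _ => ∅, 0, ⟨rfl, by simp⟩, rfl, fun _ _ => h⟩
  | step Q Q' _ hs hc ih =>
    obtain ⟨P, τ, ⟨h0, h1⟩, h2, h3⟩ := ih
    refine ⟨fun t => if t ≤ τ then P t else Q', τ + 1, ⟨by simpa using h0, ?_⟩, by simp, ?_⟩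
    · intro t ht
      rcases Nat.lt_or_ge t τ with h | h
      · have h4 : t + 1 ≤ τ := h
        simpa [h.le, h4] using h1 t h
      · have : t = τ := by omega
        subst this
        simpa [h2] using hs
    · intro t ht
      by_cases h : t ≤ τ
      · simpa [h] using h3 t h
      · simpa [h] using hc

theorem rch_of_pebbling {G : Dgraph} {c : Finset G.V → Prop} {P : ℕ → Finset G.V} {τ : ℕ}
    (h : G.IsRevPebbling P τ) (hc : ∀ t ≤ τ, c (P t)) : ∀ t ≤ τ, Rch G c (P t) := by
  intro t
  induction t with
  | zero =>
    intro _
    have := hc 0 (Nat.zero_le _)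
    rw [h.1] at this ⊢
    exact Rch.nil this
  | succ n ih =>
    intro hn
    exact Rch.step _ _ (ih (by omega)) (h.2 n (by omega)) (hc _ hn)

theorem Rch.cond {G : Dgraph} {c : Finset G.V → Prop} {Q : Finset G.V}
    (h : Rch G c Q) : c Q := by
  cases h <;> assumption

theorem Rch.removes {G : Dgraph} {k : ℕ} {Q : Finset G.V}
    (h : Rch G (fun P => P.card ≤ k) Q) (D : Finset G.V) :
    (∀ v ∈ D, ∀ u, G.edge u v → u ∈ Q ∧ u ∉ D) →
    Rch G (fun P => P.card ≤ k) (Q \ D) := by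
  induction D using Finset.induction_on with
  | empty => intro _; simpa using h
  | insert a D ha ih =>
    intro hD
    have h1 := ih (fun v hv u hu => by
      have := hD v (Finset.mem_insert_of_mem hv) u hu
      simp only [Finset.mem_insert, not_or] at this
      exact ⟨this.1, this.2.2⟩)
    have he : Q \ insert a D = (Q \ D).erase a := by ext x; simp; tauto
    rw [he]
    by_cases haQ : a ∈ Q
    · refine Rch.step _ _ h1 (Or.inr ⟨a, by simp [haQ, ha], ?_, rfl⟩) ?_
      · intro u hu
        have := hD a (Finset.mem_insert_self _ _) u hu
        simp only [Finset.mem_insert, not_or] at this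
        simp [this.1, this.2.2]
      · exact (Finset.card_le_card (Finset.erase_subset _ _)).trans h1.cond
    · rw [Finset.erase_eq_of_notMem (by simp [haQ])]
      exact h1

theorem Rch.adds {G : Dgraph} {k : ℕ} {Q : Finset G.V}
    (h : Rch G (fun P => P.card ≤ k) Q) (D : Finset G.V) :
    (Q ∪ D).card ≤ k → (∀ v ∈ D, ∀ u, G.edge u v → u ∈ Q) →
    Rch G (fun P => P.card ≤ k) (Q ∪ D) := by
  induction D using Finset.induction_on with
  | empty => intro _ _; simpa using h
  | insert a D ha ih =>
    intro hk hD
    have he : Q ∪ insert a D = insert a (Q ∪ D) := by ext x; simp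
    rw [he] at hk ⊢
    have h1 := ih ((Finset.card_le_card (Finset.subset_insert _ _)).trans hk)
      (fun v hv => hD v (Finset.mem_insert_of_mem hv))
    by_cases haQ : a ∈ Q ∪ D
    · rw [Finset.insert_eq_of_mem haQ]; exact h1
    · refine Rch.step _ _ h1 (Or.inl ⟨a, haQ, ?_, rfl⟩) hk
      intro u hu
      exact Finset.mem_union_left _ (hD a (Finset.mem_insert_self _ _) u hu)

theorem Rch.flush {G : Dgraph} {k : ℕ} {Q U : Finset G.V}
    (h : Rch G (fun P => P.card ≤ k) Q) (hU : U.card ≤ k)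
    (hd : ∀ v, ¬ (v ∈ U ↔ v ∈ Q) → ∀ u, G.edge u v → u ∈ U ∧ u ∈ Q) :
    Rch G (fun P => P.card ≤ k) U := by
  have h1 := h.removes (Q \ U) (by
    intro v hv u hu
    simp only [Finset.mem_sdiff] at hv ⊢
    have := hd v (by tauto) u hu
    tauto)
  have he : (Q \ (Q \ U)) ∪ (U \ Q) = U := by ext x; simp; tauto
  have h2 := h1.adds (U \ Q) (by rw [he]; exact hU) (by
    intro v hv u hu
    simp only [Finset.mem_sdiff] at hv ⊢
    have := hd v (by tauto) u hu
    tauto)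
  rwa [he] at h2

/-- The vertex `v^in`. -/
def mIn (G : Dgraph) (v : G.V) : (mold G).V := some (v, false)

theorem mold_cases (G : Dgraph) (x : (mold G).V) :
    x = moldSrc G ∨ (∃ v, x = mIn G v) ∨ (∃ v, x = moldOut G v) := by
  rcases x with _ | ⟨v, _ | _⟩
  · exact Or.inl rfl
  · exact Or.inr (Or.inl ⟨v, rfl⟩)
  · exact Or.inr (Or.inr ⟨v, rfl⟩)

theorem mIn_inj {G : Dgraph} {u v : G.V} : mIn G u = mIn G v ↔ u = v := by
  constructor
  · intro h; exact congrArg Prod.fst (Option.some.inj h)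
  · rintro rfl; rfl

theorem mOut_inj {G : Dgraph} {u v : G.V} : moldOut G u = moldOut G v ↔ u = v := by
  constructor
  · intro h; exact congrArg Prod.fst (Option.some.inj h)
  · rintro rfl; rfl

theorem mIn_ne_mOut {G : Dgraph} (u v : G.V) : mIn G u ≠ moldOut G v := by
  intro h
  exact Bool.false_ne_true (congrArg Prod.snd (Option.some.inj h))

theorem mIn_ne_src {G : Dgraph} (u : G.V) : mIn G u ≠ moldSrc G := by
  intro h
  exact Option.some_ne_none _ h

theorem mOut_ne_src {G : Dgraph} (u : G.V) : moldOut G u ≠ moldSrc G := by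
  intro h
  exact Option.some_ne_none _ h

theorem edge_src {G : Dgraph} (x : (mold G).V) : ¬ (mold G).edge x (moldSrc G) := by
  rcases x with _ | ⟨v, _ | _⟩ <;> exact id

theorem edge_mIn {G : Dgraph} (x : (mold G).V) (v : G.V) :
    (mold G).edge x (mIn G v) ↔ ∃ u, G.edge u v ∧ x = moldOut G u := by
  constructor
  · intro h
    rcases x with _ | ⟨u, _ | _⟩
    · exact h.elim
    · exact h.elim
    · exact ⟨u, h, rfl⟩
  · rintro ⟨u, h, rfl⟩; exact h

theorem edge_mOut {G : Dgraph} (x : (mold G).V) (v : G.V) :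
    (mold G).edge x (moldOut G v) ↔ x = moldSrc G ∨ x = mIn G v := by
  constructor
  · intro h
    rcases x with _ | ⟨u, _ | _⟩
    · exact Or.inl rfl
    · right; have h' : u = v := h
      rw [h']; rfl
    · exact h.elim
  · rintro (rfl | rfl)
    · exact trivial
    · exact rfl

open Classical in
/-- Projection of a configuration of the molding. -/
noncomputable def proj (G : Dgraph) (P : Finset (mold G).V) : Finset G.V :=
  Finset.univ.filter fun v => mIn G v ∈ P ∨ moldOut G v ∈ P

theorem mem_proj {G : Dgraph} {P : Finset (mold G).V} {v : G.V} :
    v ∈ proj G P ↔ mIn G v ∈ P ∨ moldOut G v ∈ P := by simp [proj]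

theorem card_proj {G : Dgraph} {P : Finset (mold G).V} {v : G.V}
    (h1 : mIn G v ∈ P) (h2 : moldOut G v ∈ P) :
    (proj G P).card + 1 ≤ (P.erase (moldSrc G)).card := by
  have h3 : mIn G v ∈ P.erase (moldSrc G) := Finset.mem_erase.2 ⟨mIn_ne_src v, h1⟩
  rw [← Finset.card_erase_add_one h3]
  apply Nat.add_le_add_right
  apply Finset.card_le_card_of_injOn
    (fun u => if moldOut G u ∈ P then moldOut G u else mIn G u)
  · intro u hu
    have hu := mem_proj.1 (Finset.mem_coe.1 hu)
    by_cases h : moldOut G u ∈ P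
    · simp [h, mOut_ne_src, (mIn_ne_mOut _ _).symm]
    · have : u ≠ v := by rintro rfl; exact h h2
      have h4 : mIn G u ∈ P := by tauto
      simp [h, mIn_ne_src, mIn_inj, this, h4]
  · intro u _ w _ huw
    by_cases h : moldOut G u ∈ P <;> by_cases h' : moldOut G w ∈ P <;>
      simp [h, h', mOut_inj, mIn_inj, mIn_ne_mOut, (mIn_ne_mOut _ _).symm] at huw <;> exact huw

/-- The invariant of the lower bound. -/
def LowInv (G : Dgraph) (k : ℕ) (P : Finset (mold G).V) : Prop :=
  ∃ Q, Rch G (fun P => P.card ≤ k) Q ∧ (∀ v, moldOut G v ∈ P → v ∈ Q) ∧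
    ∀ v, ¬ (v ∈ proj G P ↔ v ∈ Q) → ∀ u, G.edge u v → moldOut G u ∈ P

theorem LowInv.flush {G : Dgraph} {k : ℕ} {P : Finset (mold G).V} (h : LowInv G k P)
    (hU : (proj G P).card ≤ k) : Rch G (fun P => P.card ≤ k) (proj G P) := by
  obtain ⟨Q, h1, h2, h3⟩ := h
  exact h1.flush hU fun v hv u hu =>
    ⟨mem_proj.2 (Or.inr (h3 v hv u hu)), h2 u (h3 v hv u hu)⟩

/-- The hypothesis on the configurations in the lower bound. -/
def LowC (G : Dgraph) (k : ℕ) (P : Finset (mold G).V) : Prop :=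
  moldSrc G ∈ P → (P.erase (moldSrc G)).card ≤ k + 1

theorem LowInv.step {G : Dgraph} {k : ℕ} {P P' : Finset (mold G).V} (h : LowInv G k P)
    (hc : LowC G k P) (hc' : LowC G k P') (hs : (mold G).RevStep P P') : LowInv G k P' := by
  obtain ⟨x, hx, hP⟩ : ∃ x, (∀ u, (mold G).edge u x → u ∈ P) ∧
      ((x ∉ P ∧ P' = insert x P) ∨ (x ∈ P ∧ P' = P.erase x)) := by
    rcases hs with ⟨v, h1, h2, h3⟩ | ⟨v, h1, h2, h3⟩
    · exact ⟨v, h2, Or.inl ⟨h1, h3⟩⟩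
    · exact ⟨v, h2, Or.inr ⟨h1, h3⟩⟩
  have hmem : ∀ y, y ≠ x → (y ∈ P' ↔ y ∈ P) := by
    intro y hy
    rcases hP with ⟨_, rfl⟩ | ⟨_, rfl⟩ <;> simp [hy]
  rcases mold_cases G x with rfl | ⟨v, rfl⟩ | ⟨v, rfl⟩
  · obtain ⟨Q, h1, h2, h3⟩ := h
    refine ⟨Q, h1, ?_, ?_⟩
    · intro v hv; exact h2 v ((hmem _ (mOut_ne_src v)).1 hv)
    · intro v hv u hu
      rw [mem_proj, hmem _ (mOut_ne_src v), hmem _ (mIn_ne_src v), ← mem_proj] at hv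
      rw [hmem _ (mOut_ne_src u)]
      exact h3 v hv u hu
  · have ho : ∀ u, moldOut G u ∈ P' ↔ moldOut G u ∈ P :=
      fun u => hmem _ (mIn_ne_mOut _ _).symm
    obtain ⟨Q, h1, h2, h3⟩ := h
    refine ⟨Q, h1, ?_, ?_⟩
    · intro w hw; exact h2 w ((ho w).1 hw)
    · intro w hw u hu
      rw [ho]
      by_cases hwv : w = v
      · subst hwv
        exact hx _ ((edge_mIn _ _).2 ⟨u, hu, rfl⟩)
      · rw [mem_proj, ho, hmem _ (fun h => hwv (mIn_inj.1 h)), ← mem_proj] at hw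
        exact h3 w hw u hu
  · have hsrc : moldSrc G ∈ P := hx _ ((edge_mOut _ _).2 (Or.inl rfl))
    have hin : mIn G v ∈ P := hx _ ((edge_mOut _ _).2 (Or.inr rfl))
    have hsrc' : moldSrc G ∈ P' := (hmem _ (mOut_ne_src v).symm).2 hsrc
    have hin' : mIn G v ∈ P' := (hmem _ (mIn_ne_mOut _ _)).2 hin
    have hpr : proj G P' = proj G P := by
      ext w
      rw [mem_proj, mem_proj, hmem _ (mIn_ne_mOut _ _)]
      by_cases hwv : w = v
      · subst hwv; simp [hin]
      · rw [hmem _ (fun h => hwv (mOut_inj.1 h))]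
    have hcard : (proj G P).card ≤ k := by
      by_cases hv : moldOut G v ∈ P
      · have := card_proj hin hv
        have := hc hsrc
        omega
      · have hv' : moldOut G v ∈ P' := by
          rcases hP with ⟨_, rfl⟩ | ⟨h, _⟩
          · simp
          · exact absurd h hv
        have := card_proj hin' hv'
        have := hc' hsrc'
        rw [hpr] at *
        omega
    refine ⟨proj G P', hpr ▸ h.flush hcard, ?_, ?_⟩
    · intro w hw; exact mem_proj.2 (Or.inr hw)
    · intro w hw; exact absurd Iff.rfl hw

theorem inv_of_rch {G : Dgraph} {k : ℕ} {P : Finset (mold G).V}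
    (h : Rch (mold G) (LowC G k) P) : LowInv G k P := by
  induction h with
  | nil h =>
    refine ⟨∅, Rch.nil (by simp), by simp, ?_⟩
    intro v hv
    exact absurd (by simp [mem_proj]) hv
  | step P P' hP hs hc ih => exact ih.step hP.cond hc hs

theorem visit_le_of_rch {G : Dgraph} {k : ℕ} {Q : Finset G.V} {z : G.V}
    (h : Rch G (fun P => P.card ≤ k) Q) (hz : z ∈ Q) : G.visit z ≤ k := by
  obtain ⟨P, τ, h1, h2, h3⟩ := h.exists_pebbling
  have hm : G.space P τ ∈ { s : ℕ | ∃ P τ, G.IsRevPebbling P τ ∧ z ∈ P τ ∧ G.space P τ = s } :=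
    ⟨P, τ, h1, h2 ▸ hz, rfl⟩
  refine (Nat.sInf_le hm).trans ?_
  apply Finset.sup_le
  intro t ht
  exact h3 t (by simpa [Nat.lt_succ_iff] using ht)

/-- The lower bound. -/
theorem low_bound {G : Dgraph} {k : ℕ} {z : G.V} {P : ℕ → Finset (mold G).V} {τ : ℕ}
    (hP : (mold G).IsRevPebbling P τ) (hz : moldOut G z ∈ P τ)
    (hc : ∀ t ≤ τ, LowC G k (P t)) : G.visit z ≤ k := by
  obtain ⟨Q, h1, h2, _⟩ := inv_of_rch (rch_of_pebbling hP hc τ le_rfl)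
  exact visit_le_of_rch h1 (h2 z hz)

/-- The lift of a configuration to the molding. -/
def lft (G : Dgraph) (Q : Finset G.V) : Finset (mold G).V :=
  insert (moldSrc G) (Q.image (moldOut G))

theorem mOut_mem_lft {G : Dgraph} {Q : Finset G.V} {v : G.V} :
    moldOut G v ∈ lft G Q ↔ v ∈ Q := by
  simp [lft, mOut_inj, mOut_ne_src]

theorem mIn_mem_lft {G : Dgraph} {Q : Finset G.V} {v : G.V} :
    mIn G v ∉ lft G Q := by
  simp [lft, mIn_ne_src, (mIn_ne_mOut _ _).symm]

theorem card_lft {G : Dgraph} {Q : Finset G.V} :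
    ((lft G Q).erase (moldSrc G)).card ≤ Q.card := by
  unfold lft
  rw [Finset.erase_insert_eq_erase]
  exact (Finset.card_le_card (Finset.erase_subset _ _)).trans Finset.card_image_le

theorem card_insert_erase {α : Type*} [DecidableEq α] (P : Finset α) (a s : α) :
    ((insert a P).erase s).card ≤ (P.erase s).card + 1 := by
  refine (Finset.card_le_card (t := insert a (P.erase s)) ?_).trans (Finset.card_insert_le _ _)
  intro x hx
  simp at hx ⊢
  tauto

/-- The condition of the upper bound. -/
def UpC (G : Dgraph) (r : ℕ) (P : Finset (mold G).V) : Prop :=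
  (P.erase (moldSrc G)).card ≤ r + 1

theorem UpC.mono {G : Dgraph} {r : ℕ} {P P' : Finset (mold G).V} (h : UpC G r P)
    (hs : P' ⊆ P) : UpC G r P' :=
  (Finset.card_le_card (Finset.erase_subset_erase _ hs)).trans h

/-- Moving a pebble `v` upwards in the lift and back down, sharing the work. -/
theorem lft_toggle {G : Dgraph} {r : ℕ} {Q : Finset G.V} {v : G.V} (hvQ : v ∉ Q)
    (hQ : Q.card + 1 ≤ r) (hpred : ∀ u, G.edge u v → u ∈ Q) :
    Rch (mold G) (UpC G r) (lft G Q) ↔ Rch (mold G) (UpC G r) (lft G (insert v Q)) := by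
  set A := lft G Q with hA
  set B := insert (mIn G v) A with hB
  set C := insert (moldOut G v) B with hC
  have hD : C.erase (mIn G v) = lft G (insert v Q) := by
    ext x
    have h1 := mIn_mem_lft (Q := Q) (v := v)
    by_cases hx : x = mIn G v
    · subst hx
      simp [mIn_mem_lft]
    · simp [hC, hB, hA, hx, lft]
      tauto
  have hins : C = insert (mIn G v) (lft G (insert v Q)) := by
    rw [← hD, Finset.insert_erase]
    simp [hC, hB]
  have hBe : C.erase (moldOut G v) = B := by
    rw [hC, Finset.erase_insert]
    simp [hB, hA, mOut_mem_lft, hvQ, (mIn_ne_mOut _ _).symm]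
  have hAe : B.erase (mIn G v) = A := by
    rw [hB, Finset.erase_insert]
    exact mIn_mem_lft
  have cC : UpC G r C := by
    have h1 := card_lft (G := G) (Q := Q)
    have h2 := card_insert_erase A (mIn G v) (moldSrc G)
    have h3 := card_insert_erase B (moldOut G v) (moldSrc G)
    rw [← hA] at h1
    rw [← hB] at h2
    rw [← hC] at h3
    unfold UpC
    omega
  have cB : UpC G r B := cC.mono (Finset.subset_insert _ _)
  have cA : UpC G r A := cB.mono (Finset.subset_insert _ _)
  have cD : UpC G r (lft G (insert v Q)) := by rw [← hD]; exact cC.mono (Finset.erase_subset _ _)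
  have eA : ∀ x, (mold G).edge x (mIn G v) → x ∈ A := by
    intro x hx
    obtain ⟨u, hu, rfl⟩ := (edge_mIn _ _).1 hx
    exact mOut_mem_lft.2 (hpred u hu)
  have eB : ∀ x, (mold G).edge x (moldOut G v) → x ∈ B := by
    intro x hx
    rcases (edge_mOut _ _).1 hx with rfl | rfl
    · simp [hB, hA, lft]
    · simp [hB]
  have hAB : A ⊆ B := Finset.subset_insert _ _
  have hBC : B ⊆ C := Finset.subset_insert _ _
  have eD : ∀ x, (mold G).edge x (mIn G v) → x ∈ lft G (insert v Q) := by
    intro x hx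
    obtain ⟨u, hu, rfl⟩ := (edge_mIn _ _).1 hx
    exact mOut_mem_lft.2 (Finset.mem_insert_of_mem (hpred u hu))
  constructor
  · intro h
    have h1 : Rch (mold G) (UpC G r) B :=
      Rch.step _ _ h (Or.inl ⟨_, mIn_mem_lft, eA, rfl⟩) cB
    have h2 : Rch (mold G) (UpC G r) C :=
      Rch.step _ _ h1 (Or.inl ⟨moldOut G v, by
        simp [hB, hA, mOut_mem_lft, hvQ, (mIn_ne_mOut _ _).symm], eB, rfl⟩) cC
    exact Rch.step _ _ h2 (Or.inr ⟨mIn G v, hBC (by simp [hB]),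
      fun x hx => hBC (hAB (eA x hx)), hD.symm⟩) cD
  · intro h
    have h1 : Rch (mold G) (UpC G r) C :=
      Rch.step _ _ h (Or.inl ⟨_, mIn_mem_lft, eD, hins⟩) cC
    have h2 : Rch (mold G) (UpC G r) B :=
      Rch.step _ _ h1 (Or.inr ⟨moldOut G v, by simp [hC],
        fun x hx => hBC (eB x hx), hBe.symm⟩) cB
    exact Rch.step _ _ h2 (Or.inr ⟨mIn G v, by simp [hB],
      fun x hx => hAB (eA x hx), hAe.symm⟩) cA

theorem rch_lft {G : Dgraph} {r : ℕ} (hacyc : ∀ v, ¬ G.edge v v) {Q : Finset G.V}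
    (h : Rch G (fun P => P.card ≤ r) Q) :
    Rch (mold G) (UpC G r) (lft G Q) := by
  induction h with
  | nil h =>
    refine Rch.step ∅ _ (Rch.nil (by simp [UpC]))
      (Or.inl ⟨moldSrc G, by simp, fun u hu => absurd hu (edge_src u), by simp [lft]⟩) ?_
    have := card_lft (G := G) (Q := ∅)
    unfold UpC
    simp at this ⊢
    simp [this]
  | step Q Q' hQ hs hc ih =>
    rcases hs with ⟨v, h1, h2, rfl⟩ | ⟨v, h1, h2, rfl⟩
    · refine (lft_toggle h1 ?_ h2).1 ih
      simpa [h1] using hc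
    · refine (lft_toggle (v := v) (by simp) ?_ ?_).2 ?_
      · rw [Finset.card_erase_add_one h1]; exact hQ.cond
      · intro u hu
        refine Finset.mem_erase.2 ⟨?_, h2 u hu⟩
        rintro rfl
        exact hacyc _ hu
      · rwa [Finset.insert_erase h1]

theorem rch_single {G : Dgraph} {r : ℕ} {z : G.V}
    (h : Rch (mold G) (UpC G r) (lft G {z})) : Rch (mold G) (UpC G r) {moldOut G z} := by
  have he : {moldOut G z} = (lft G {z}).erase (moldSrc G) := by
    unfold lft
    rw [Finset.erase_insert]
    · simp
    · simp [(mOut_ne_src _).symm]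
  refine Rch.step _ _ h (Or.inr ⟨moldSrc G, by simp [lft],
    fun u hu => absurd hu (edge_src u), he⟩) ?_
  rw [he]
  exact h.cond.mono (Finset.erase_subset _ _)

theorem ncard_univ {G : Dgraph} (P : Finset G.V) :
    ((P : Set G.V) ∩ Set.univ).ncard = P.card := by simp

theorem ncard_ne {G : Dgraph} (P : Finset G.V) (a : G.V) :
    ((P : Set G.V) ∩ {x | x ≠ a}).ncard = (P.erase a).card := by
  rw [← Set.ncard_coe_finset]
  congr 1
  ext x
  simp [and_comm]

theorem prices_eq {G : Dgraph} {R : Set G.V} {b : G.V} {N : ℕ} (hb : b ∈ R)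
    (hup : ∃ P τ, G.IsRevPebbling P τ ∧ P τ = {b} ∧ G.spaceIn R P τ ≤ N)
    (hlow : ∀ P τ, G.IsRevPebbling P τ → b ∈ P τ → N ≤ G.spaceIn R P τ) :
    G.persIn R b = N ∧ G.visitIn R b = N := by
  obtain ⟨P, τ, h1, h2, h3⟩ := hup
  have h4 : ((P τ : Set G.V) ∩ R) = {b} := by
    rw [h2]; simpa using hb
  have h5 : b ∈ P τ := by simp [h2]
  have hm4 : G.spaceIn R P τ ∈ { s : ℕ | ∃ P τ, G.IsRevPebbling P τ ∧
      ((P τ : Set G.V) ∩ R) = {b} ∧ G.spaceIn R P τ = s } := ⟨P, τ, h1, h4, rfl⟩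
  have hm5 : G.spaceIn R P τ ∈ { s : ℕ | ∃ P τ, G.IsRevPebbling P τ ∧
      b ∈ P τ ∧ G.spaceIn R P τ = s } := ⟨P, τ, h1, h5, rfl⟩
  constructor
  · apply le_antisymm
    · exact (Nat.sInf_le hm4).trans h3
    · apply le_csInf ⟨_, hm4⟩
      rintro s ⟨P', τ', g1, g2, rfl⟩
      apply hlow _ _ g1
      have : b ∈ ((P' τ' : Set G.V) ∩ R) := by rw [g2]; simp
      exact this.1
  · apply le_antisymm
    · exact (Nat.sInf_le hm5).trans h3
    · apply le_csInf ⟨_, hm5⟩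
      rintro s ⟨P', τ', g1, g2, rfl⟩
      exact hlow _ _ g1 g2

/-- Turnpikes (Lemma `lem:Highway`): for the molding `H = mold T` of a graph `T` with
`Visit(T) = Pers(T) = r`, counting pebbles over all of `H` gives restricted persistent and
visiting prices `r + 2` for the sink, and counting pebbles only away from the special
source gives `r + 1`. -/
theorem turnpike (r : ℕ) (hr : 1 ≤ r) (T : Dgraph) (hT : T.Acyclic)
    (z : T.V) (hz : T.UniqueSink z) (hv : T.visit z = r) (hp : T.pers z = r) :
    (mold T).persIn Set.univ (moldOut T z) = r + 2 ∧
    (mold T).visitIn Set.univ (moldOut T z) = r + 2 ∧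
    (mold T).persIn {x | x ≠ moldSrc T} (moldOut T z) = r + 1 ∧
    (mold T).visitIn {x | x ≠ moldSrc T} (moldOut T z) = r + 1 := by
  have hTr : Rch T (fun P => P.card ≤ r) {z} := by
    have hne : { s : ℕ | ∃ P τ, T.IsRevPebbling P τ ∧ P τ = {z} ∧ T.space P τ = s }.Nonempty := by
      by_contra hcon
      rw [Set.not_nonempty_iff_eq_empty] at hcon
      unfold Dgraph.pers at hp
      rw [hcon, Nat.sInf_empty] at hp
      omega
    obtain ⟨P, τ, h1, h2, h3⟩ := Nat.sInf_mem hne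
    rw [← h2]
    refine rch_of_pebbling h1 ?_ τ le_rfl
    intro t ht
    have h4 : T.space P τ = r := h3.trans hp
    rw [← h4]
    exact Finset.le_sup (f := fun t => (P t).card) (by simpa [Nat.lt_succ_iff] using ht)
  have hup := rch_single (rch_lft (fun v hv => hT v (Relation.TransGen.single hv)) hTr)
  obtain ⟨P, τ, h1, h2, h3⟩ := hup.exists_pebbling
  have key : ∀ P τ, (mold T).IsRevPebbling P τ → moldOut T z ∈ P τ →
      ∃ t ≤ τ, moldSrc T ∈ P t ∧ r + 1 ≤ ((P t).erase (moldSrc T)).card := by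
    intro P τ g1 g2
    by_contra! hcon
    have := low_bound (k := r - 1) g1 g2 (by
      intro t ht hs
      have := hcon t ht hs
      omega)
    omega
  have A := prices_eq (G := mold T) (R := Set.univ) (b := moldOut T z) (N := r + 2)
    (Set.mem_univ _)
    ⟨P, τ, h1, h2, by
      apply Finset.sup_le
      intro t ht
      have h4 := h3 t (by simpa [Nat.lt_succ_iff] using ht)
      rw [ncard_univ]
      unfold UpC at h4
      have := Finset.pred_card_le_card_erase (s := P t) (a := moldSrc T)
      omega⟩
    (by
      intro P τ g1 g2
      obtain ⟨t, ht, hs, hc⟩ := key P τ g1 g2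
      refine le_trans ?_ (Finset.le_sup (b := t) (by simpa [Nat.lt_succ_iff] using ht))
      rw [ncard_univ, ← Finset.card_erase_add_one hs]
      omega)
  have B := prices_eq (G := mold T) (R := {x | x ≠ moldSrc T}) (b := moldOut T z) (N := r + 1)
    (mOut_ne_src z)
    ⟨P, τ, h1, h2, by
      apply Finset.sup_le
      intro t ht
      have h4 := h3 t (by simpa [Nat.lt_succ_iff] using ht)
      rw [ncard_ne]
      exact h4⟩
    (by
      intro P τ g1 g2
      obtain ⟨t, ht, hs, hc⟩ := key P τ g1 g2
      refine le_trans ?_ (Finset.le_sup (b := t) (by simpa [Nat.lt_succ_iff] using ht))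
      rw [ncard_ne]
      exact hc)
  exact ⟨A.1, A.2, B.1, B.2⟩
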